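/- Let q ≡ 1 (mod 5) and let χ be a multiplicative character of F_q^* of order 5. Then, as complex numbers, the number of tuples (x_1,…,x_5) ∈ F_q^5 with (x_1,…,x_5) ≠ (0,…,0) and x_1^5 + x_2^5 + x_3^5 + x_4^5 + x_5^5 = 0 equals (q−1)·( 1 + q + q^2 + q^3 + (1/q)·Σ_{j=1}^{4} G(φ,χ^j)^5 + 50·Σ_{j=1}^{4} G(φ,χ^j)^2·G(φ,χ^{3j}) ). -/

import Mathlib

/-- The Gauss sum `G(φ, χ) = ∑_{x ∈ F*} φ(x) χ(x)`. -/
noncomputable def gaussSum' {F : Type*} [Field F] [Fintype F]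
    (φ : AddChar F ℂ) (χ : MulChar F ℂ) : ℂ :=
  letI := Classical.decEq F
  ∑ x : Fˣ, φ (x : F) * χ (x : F)

section DiagonalEquation

open Finset AddChar

variable {F : Type*} [Field F] [Fintype F]

lemma sum_eq_zero_add_sum_units (f : F → ℂ) [DecidableEq F] :
    ∑ x, f x = f 0 + ∑ u : Fˣ, f u := by
  rw [Fintype.sum_eq_add_sum_compl 0]
  congr 1
  symm
  refine Finset.sum_bij (fun u _ ↦ (u : F)) (by simp) (fun _ _ _ _ h ↦ Units.ext h) ?_
    fun u _ ↦ rfl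
  intro b hb
  exact ⟨Units.mk0 b (by simpa using hb), mem_univ _, rfl⟩

lemma gaussSum'_eq_gaussSum (φ : AddChar F ℂ) (χ : MulChar F ℂ) :
    gaussSum' φ χ = gaussSum χ φ := by
  classical
  simp [gaussSum', gaussSum, sum_eq_zero_add_sum_units, MulChar.map_zero, mul_comm]

lemma AddChar.map_sum_eq_prod {A M ι : Type*} [AddCommMonoid A] [CommMonoid M]
    (ψ : AddChar A M) (s : Finset ι) (f : ι → A) : ψ (∑ i ∈ s, f i) = ∏ i ∈ s, ψ (f i) :=
  map_prod ψ.toMonoidHom (fun i ↦ Multiplicative.ofAdd (f i)) s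

/-- A unit on which a character of order `n` is trivial is an `n`-th power. -/
lemma MulChar.exists_pow_eq_of_apply_eq_one {χ : MulChar F ℂ} {u : Fˣ} (hu : χ u = 1) :
    ∃ v : Fˣ, v ^ orderOf χ = u := by
  obtain ⟨g, hg⟩ := IsCyclic.exists_generator (α := Fˣ)
  obtain ⟨k, rfl⟩ := mem_powers_iff_mem_zpowers.mpr (hg u)
  have h : χ ^ k = 1 := by
    rw [MulChar.eq_iff hg, MulChar.pow_apply_coe, MulChar.one_apply_coe, ← hu]
    simp
  obtain ⟨m, rfl⟩ := orderOf_dvd_of_pow_eq_one h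
  exact ⟨g ^ m, by rw [← pow_mul, mul_comm]⟩

lemma MulChar.apply_pow_orderOf {K : Type*} [Field K] (χ : MulChar K ℂ) (u : Kˣ) :
    χ u ^ orderOf χ = 1 := by
  rw [← MulChar.pow_apply_coe, pow_orderOf_eq_one, MulChar.one_apply_coe]

lemma MulChar.card_pow_eq (χ : MulChar F ℂ) (u : Fˣ) [DecidableEq F] :
    (#{v : Fˣ | v ^ orderOf χ = u} : ℂ) = ∑ j ∈ range (orderOf χ), χ u ^ j := by
  by_cases hu : χ u = 1
  · have h := MonoidHom.card_fiber_eq_of_mem_range (powMonoidHom (α := Fˣ) (orderOf χ))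
      (x := u) (y := 1) (MulChar.exists_pow_eq_of_apply_eq_one hu) ⟨1, by simp⟩
    have hker := IsCyclic.card_powMonoidHom_ker Fˣ (orderOf χ)
    rw [Nat.card_eq_fintype_card (α := Fˣ), Fintype.card_units,
      Nat.gcd_eq_right χ.orderOf_dvd_card_sub_one] at hker
    have hone : #{v : Fˣ | v ^ orderOf χ = 1} = orderOf χ := by
      rwa [← Fintype.card_subtype, ← Nat.card_eq_fintype_card]
    simp only [powMonoidHom_apply] at h
    rw [h, hone, hu]
    simp
  · rw [geom_sum_eq hu, χ.apply_pow_orderOf, sub_self, zero_div, Nat.cast_eq_zero, card_eq_zero,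
      filter_eq_empty_iff]
    rintro v - rfl
    exact hu (by rw [Units.val_pow_eq_pow_val, map_pow, χ.apply_pow_orderOf])

lemma MulChar.sum_comp_pow (χ : MulChar F ℂ) (f : F → ℂ) [DecidableEq F] :
    ∑ x, f (x ^ orderOf χ) = f 0 + ∑ j ∈ range (orderOf χ), ∑ u : Fˣ, (χ ^ j) u * f u := by
  rw [sum_eq_zero_add_sum_units, zero_pow χ.orderOf_pos.ne', sum_comm]
  congr 1
  rw [← sum_fiberwise univ (fun v : Fˣ ↦ v ^ orderOf χ)]
  refine sum_congr rfl fun u _ ↦ ?_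
  simp_rw [← sum_mul, MulChar.pow_apply_coe, ← χ.card_pow_eq u, ← nsmul_eq_mul]
  rw [← sum_const]
  refine sum_congr rfl fun v hv ↦ ?_
  rw [← (mem_filter.mp hv).2, Units.val_pow_eq_pow_val]

lemma MulChar.sum_addChar_comp_pow (χ : MulChar F ℂ) {φ : AddChar F ℂ} (hφ : φ ≠ 1) (t : Fˣ) :
    ∑ x, φ (t * x ^ orderOf χ) =
      ∑ j ∈ Ico 1 (orderOf χ), (χ⁻¹ t) ^ j * gaussSum (χ ^ j) φ := by
  classical
  have hsum (j : ℕ) : ∑ u : Fˣ, (χ ^ j) u * φ (t * u) = (χ⁻¹ t) ^ j * gaussSum (χ ^ j) φ := by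
    rw [← MulChar.pow_apply_coe, inv_pow, ← gaussSum_mulShift_eq, ← gaussSum'_eq_gaussSum,
      gaussSum']
    simp [mul_comm]
  rw [χ.sum_comp_pow (fun y ↦ φ (t * y)), range_eq_Ico, sum_eq_sum_Ico_succ_bot χ.orderOf_pos]
  simp_rw [hsum]
  simp [gaussSum_one_left hφ]

lemma MulChar.sum_units_pow (χ : MulChar F ℂ) [DecidableEq F] {j : ℕ} (hj : χ ^ j ≠ 1) :
    ∑ u : Fˣ, χ u ^ j = 0 := by
  have h := MulChar.sum_eq_zero_of_ne_one hj
  rw [sum_eq_zero_add_sum_units, MulChar.map_zero, zero_add] at h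
  simpa [MulChar.pow_apply_coe] using h

/-- The number of zeros of a function on a finite type, as a sum over a nontrivial additive
character. -/
lemma AddChar.card_mul_card_zeros {ι : Type*} [Fintype ι] [DecidableEq F] {φ : AddChar F ℂ}
    (hφ : φ ≠ 1) (f : ι → F) :
    (Fintype.card F : ℂ) * #{i | f i = 0} = ∑ t, ∑ i, φ (t * f i) := by
  rw [sum_comm]
  simp_rw [AddChar.sum_mulShift _ (IsPrimitive.of_ne_one hφ), Nat.cast_ite, Nat.cast_zero]
  rw [← sum_filter, sum_const, nsmul_eq_mul, mul_comm]

/-- The number of zeros of the diagonal form `∑ xᵢᵐ` in terms of Gauss sums, for `m = orderOf χ`. -/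
lemma card_diagonal_zeros [DecidableEq F] {χ : MulChar F ℂ}
    {φ : AddChar F ℂ} (hφ : φ ≠ 1) (n : ℕ) :
    (Fintype.card F : ℂ) * #{x : Fin n → F | ∑ i, x i ^ orderOf χ = 0} =
      (Fintype.card F : ℂ) ^ n +
        ∑ t : Fˣ, (∑ j ∈ Ico 1 (orderOf χ), (χ⁻¹ t) ^ j * gaussSum (χ ^ j) φ) ^ n := by
  rw [AddChar.card_mul_card_zeros hφ, sum_eq_zero_add_sum_units]
  congr 1
  · simp
  · refine sum_congr rfl fun t _ ↦ ?_
    rw [← χ.sum_addChar_comp_pow hφ, Fintype.sum_pow]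
    simp_rw [mul_sum, ← AddChar.map_sum_eq_prod]

lemma cyclic_mul_five {R : Type*} [CommRing R] {z : R} (hz : z ^ 5 = 1)
    (a₀ a₁ a₂ a₃ a₄ b₀ b₁ b₂ b₃ b₄ : R) :
    (a₀ + z * a₁ + z ^ 2 * a₂ + z ^ 3 * a₃ + z ^ 4 * a₄) *
        (b₀ + z * b₁ + z ^ 2 * b₂ + z ^ 3 * b₃ + z ^ 4 * b₄) =
      (a₀ * b₀ + a₁ * b₄ + a₂ * b₃ + a₃ * b₂ + a₄ * b₁) +
      z * (a₀ * b₁ + a₁ * b₀ + a₂ * b₄ + a₃ * b₃ + a₄ * b₂) +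
      z ^ 2 * (a₀ * b₂ + a₁ * b₁ + a₂ * b₀ + a₃ * b₄ + a₄ * b₃) +
      z ^ 3 * (a₀ * b₃ + a₁ * b₂ + a₂ * b₁ + a₃ * b₀ + a₄ * b₄) +
      z ^ 4 * (a₀ * b₄ + a₁ * b₃ + a₂ * b₂ + a₃ * b₁ + a₄ * b₀) := by
  linear_combination ((a₁ * b₄ + a₂ * b₃ + a₃ * b₂ + a₄ * b₁) +
    z * (a₂ * b₄ + a₃ * b₃ + a₄ * b₂) + z ^ 2 * (a₃ * b₄ + a₄ * b₃) + z ^ 3 * (a₄ * b₄)) * hz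

/-- The constant term of the fifth power of `az + bz² + cz³ + dz⁴` modulo `z⁵ - 1`. -/
lemma exists_cyclic_fifth_power {R : Type*} [CommRing R] (a b c d : R) :
    ∃ p₁ p₂ p₃ p₄ : R, ∀ z : R, z ^ 5 = 1 →
      (z * a + z ^ 2 * b + z ^ 3 * c + z ^ 4 * d) ^ 5 =
        (a ^ 5 + b ^ 5 + c ^ 5 + d ^ 5 +
          20 * (a ^ 3 * c * d + b ^ 3 * a * c + c ^ 3 * b * d + d ^ 3 * a * b) +
          30 * (a ^ 2 * b * c ^ 2 + a ^ 2 * b ^ 2 * d + a * c ^ 2 * d ^ 2 + b ^ 2 * c * d ^ 2)) +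
        z * p₁ + z ^ 2 * p₂ + z ^ 3 * p₃ + z ^ 4 * p₄ := by
  let e₀ := 2 * a * d + 2 * b * c
  let e₁ := 2 * b * d + c ^ 2
  let e₂ := a ^ 2 + 2 * c * d
  let e₃ := 2 * a * b + d ^ 2
  let e₄ := 2 * a * c + b ^ 2
  let f₀ := e₀ ^ 2 + 2 * e₁ * e₄ + 2 * e₂ * e₃
  let f₁ := 2 * e₀ * e₁ + 2 * e₂ * e₄ + e₃ ^ 2
  let f₂ := 2 * e₀ * e₂ + e₁ ^ 2 + 2 * e₃ * e₄
  let f₃ := 2 * e₀ * e₃ + 2 * e₁ * e₂ + e₄ ^ 2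
  let f₄ := 2 * e₀ * e₄ + 2 * e₁ * e₃ + e₂ ^ 2
  refine ⟨f₀ * a + f₂ * d + f₃ * c + f₄ * b, f₀ * b + f₁ * a + f₃ * d + f₄ * c,
    f₀ * c + f₁ * b + f₂ * a + f₄ * d, f₀ * d + f₁ * c + f₂ * b + f₃ * a, fun z hz ↦ ?_⟩
  rw [show (z * a + z ^ 2 * b + z ^ 3 * c + z ^ 4 * d) ^ 5 =
      (((0 + z * a + z ^ 2 * b + z ^ 3 * c + z ^ 4 * d) *
        (0 + z * a + z ^ 2 * b + z ^ 3 * c + z ^ 4 * d)) *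
      ((0 + z * a + z ^ 2 * b + z ^ 3 * c + z ^ 4 * d) *
        (0 + z * a + z ^ 2 * b + z ^ 3 * c + z ^ 4 * d))) *
      (0 + z * a + z ^ 2 * b + z ^ 3 * c + z ^ 4 * d) by ring,
    cyclic_mul_five hz, cyclic_mul_five hz, cyclic_mul_five hz]
  ring

lemma MulChar.sum_units_cyclic_fifth_power [DecidableEq F] {χ : MulChar F ℂ}
    (hχ : orderOf χ = 5) (a b c d : ℂ) :
    ∑ t : Fˣ, (χ t * a + χ t ^ 2 * b + χ t ^ 3 * c + χ t ^ 4 * d) ^ 5 =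
      ((Fintype.card F : ℂ) - 1) * (a ^ 5 + b ^ 5 + c ^ 5 + d ^ 5 +
        20 * (a ^ 3 * c * d + b ^ 3 * a * c + c ^ 3 * b * d + d ^ 3 * a * b) +
        30 * (a ^ 2 * b * c ^ 2 + a ^ 2 * b ^ 2 * d + a * c ^ 2 * d ^ 2 + b ^ 2 * c * d ^ 2)) := by
  obtain ⟨p₁, p₂, p₃, p₄, hp⟩ := exists_cyclic_fifth_power a b c d
  have hsum {j : ℕ} (h0 : j ≠ 0) (h5 : j < 5) : ∑ t : Fˣ, χ t ^ j = 0 :=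
    χ.sum_units_pow (pow_ne_one_of_lt_orderOf h0 (hχ ▸ h5))
  have h1 := hsum one_ne_zero (by norm_num)
  simp only [pow_one] at h1
  have hcard : (Fintype.card Fˣ : ℂ) = (Fintype.card F : ℂ) - 1 := by
    rw [Fintype.card_units, Nat.cast_sub Fintype.card_pos, Nat.cast_one]
  simp_rw [fun t : Fˣ ↦ hp (χ t) (hχ ▸ χ.apply_pow_orderOf t), sum_add_distrib, ← sum_mul]
  rw [h1, hsum two_ne_zero (by norm_num), hsum three_ne_zero (by norm_num),
    hsum four_ne_zero (by norm_num)]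
  simp only [hcard, zero_mul, add_zero, sum_const, card_univ, nsmul_eq_mul]
  ring

lemma card_ne_zero_and_diagonal_zeros [DecidableEq F] {n m : ℕ} (hm : m ≠ 0) :
    (Nat.card {x : Fin n → F // x ≠ 0 ∧ ∑ i, x i ^ m = 0} : ℂ) =
      #{x : Fin n → F | ∑ i, x i ^ m = 0} - 1 := by
  have h0 : (0 : Fin n → F) ∈ ({x | ∑ i, x i ^ m = 0} : Finset (Fin n → F)) := by simp [hm]
  rw [Nat.card_eq_fintype_card, Fintype.card_subtype, ← Nat.cast_one (R := ℂ), ← Nat.cast_sub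
    (card_pos.mpr ⟨0, h0⟩), ← card_erase_of_mem h0]
  congr 2
  ext x
  simp

end DiagonalEquation

open Finset AddChar in
/-- Let `F` be a finite field with `q ≡ 1 (mod 5)` elements of
characteristic `p ≠ 5`, let `φ` be a nontrivial additive character of `F` with values in
`ℂ`, and let `χ` be a multiplicative character of `F` of order `5`. The number of tuples
`(x₁, …, x₅) ∈ F⁵`, not all zero, with `x₁⁵ + ⋯ + x₅⁵ = 0` equals
`(q-1)(1 + q + q² + q³ + (1/q) ∑_{j=1}^{4} G(φ,χ^j)⁵ + 50 ∑_{j=1}^{4} G(φ,χ^j)² G(φ,χ^{3j}))`. -/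
theorem stmt_11 {F : Type*} [Field F] [Fintype F] (hchar : ringChar F ≠ 5)
    (hq : Fintype.card F % 5 = 1) (φ : AddChar F ℂ) (hφ : φ ≠ 1)
    (χ : MulChar F ℂ) (hχ : orderOf χ = 5) :
    (Nat.card {x : Fin 5 → F // x ≠ 0 ∧ ∑ i, x i ^ 5 = 0} : ℂ) =
      ((Fintype.card F : ℂ) - 1) *
        (1 + (Fintype.card F : ℂ) + (Fintype.card F : ℂ) ^ 2 + (Fintype.card F : ℂ) ^ 3 +
          (1 / (Fintype.card F : ℂ)) * ∑ j ∈ Finset.Icc 1 4, gaussSum' φ (χ ^ j) ^ 5 +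
          50 * ∑ j ∈ Finset.Icc 1 4, gaussSum' φ (χ ^ j) ^ 2 * gaussSum' φ (χ ^ (3 * j))) := by
  classical
  have hχ5 : χ ^ 5 = 1 := hχ ▸ pow_orderOf_eq_one χ
  have hcount := card_diagonal_zeros (χ := χ) hφ 5
  have hinv : orderOf χ⁻¹ = 5 := by rw [orderOf_inv, hχ]
  have hIcc (f : ℕ → ℂ) : ∑ j ∈ Icc 1 4, f j = f 1 + f 2 + f 3 + f 4 := by
    simp [show Icc 1 4 = ({1, 2, 3, 4} : Finset ℕ) from rfl, add_assoc]
  have hprod {i j : ℕ} (hi : i ≠ 0) (hi5 : i < 5) (hij : i + j = 5) :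
      gaussSum (χ ^ i) φ * gaussSum (χ ^ j) φ = Fintype.card F := by
    have hne : χ ^ i ≠ 1 := pow_ne_one_of_lt_orderOf hi (hχ ▸ hi5)
    have hj : χ ^ j = (χ ^ i)⁻¹ := eq_inv_of_mul_eq_one_right (by rw [← pow_add, hij, hχ5])
    have hneg : (χ ^ i)⁻¹ (-1) = 1 := MulChar.val_neg_one_eq_one_of_odd_order (n := 5)
      (by decide) (by rw [inv_pow, pow_right_comm, hχ5, one_pow, inv_one])
    rw [hj, ← mul_gaussSum_inv_eq_gaussSum (χ ^ i)⁻¹, hneg, one_mul,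
      gaussSum_mul_gaussSum_eq_card hne (IsPrimitive.of_ne_one hφ)]
  have h14 := hprod (i := 1) (j := 4) (by norm_num) (by norm_num) rfl
  have h23 := hprod (i := 2) (j := 3) (by norm_num) (by norm_num) rfl
  have h6 : χ ^ (3 * 2) = χ ^ 1 := by rw [pow_succ, hχ5, one_mul, pow_one]
  have h9 : χ ^ (3 * 3) = χ ^ 4 := by rw [show 3 * 3 = 5 + 4 from rfl, pow_add, hχ5, one_mul]
  have h12 : χ ^ (3 * 4) = χ ^ 2 := by
    rw [show 3 * 4 = 5 + 5 + 2 from rfl, pow_add, pow_add, hχ5, one_mul, one_mul]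
  rw [hχ, show Ico 1 5 = Icc 1 4 from rfl] at hcount
  simp_rw [hIcc] at hcount
  simp only [pow_one (χ⁻¹ _)] at hcount
  rw [MulChar.sum_units_cyclic_fifth_power hinv] at hcount
  have hq0 : (Fintype.card F : ℂ) ≠ 0 := Nat.cast_ne_zero.mpr Fintype.card_ne_zero
  rw [card_ne_zero_and_diagonal_zeros (by norm_num)]
  simp_rw [gaussSum'_eq_gaussSum, hIcc, h6, h9, h12, show 3 * 1 = 3 from rfl]
  generalize gaussSum (χ ^ 1) φ = a at *
  generalize gaussSum (χ ^ 2) φ = b at *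
  generalize gaussSum (χ ^ 3) φ = c at *
  generalize gaussSum (χ ^ 4) φ = d at *
  generalize (Fintype.card F : ℂ) = q at *
  apply mul_left_cancel₀ hq0
  rw [mul_sub, hcount]
  field_simp
  linear_combination (q - 1) * (20 * (a ^ 2 * c + d ^ 2 * b) + 30 * (b ^ 2 * a + c ^ 2 * d)) * h14 +
    (q - 1) * (20 * (b ^ 2 * a + c ^ 2 * d) + 30 * (a ^ 2 * c + d ^ 2 * b)) * h23
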